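/- arXiv:1203.2476 — 3 statements merged into one kernel-verified Lean document; each statement's English description precedes it below -/
import Mathlib

section
/- For every measurable function g : ℝ → ℂ, the identity ∫₀^∞ √s · ( (2/π) ∫_ℝ ξ² / (ξ² + s)² · |g(ξ)|² dξ ) ds = ∫_ℝ |ξ| · |g(ξ)|² dξ holds as an identity in [0, ∞] (both sides may be infinite). -/
open MeasureTheory ENNReal

open Filter Topology in
theorem tendsto_sqrt_div_add_atTop_zero {c : ℝ} (hc : 0 ≤ c) :
    Tendsto (fun s : ℝ => √s / (s + c)) atTop (𝓝 0) := by
  refine tendsto_of_tendsto_of_tendsto_of_le_of_le' tendsto_const_nhds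
    (tendsto_inv_atTop_zero.comp Real.tendsto_sqrt_atTop) ?_ ?_
  · filter_upwards [eventually_gt_atTop 0] with s hs
    positivity
  · filter_upwards [eventually_gt_atTop 0] with s hs
    have h := Real.sqrt_pos.2 hs
    rw [Function.comp_apply, inv_eq_one_div, div_le_div_iff₀ (by positivity) h,
      Real.mul_self_sqrt hs.le]
    linarith

theorem hasDerivAt_arctan_sqrt_div_sub {a s : ℝ} (ha : 0 < a) (hs : 0 < s) :
    HasDerivAt (fun s : ℝ => a * Real.arctan (√s / a) - a ^ 2 * (√s / (s + a ^ 2)))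
      (√s * (a ^ 2 / (a ^ 2 + s) ^ 2)) s := by
  have hsqrt := Real.hasDerivAt_sqrt hs.ne'
  have hne : s + a ^ 2 ≠ 0 := by positivity
  refine (((hsqrt.div_const a).arctan.const_mul a).sub
    ((hsqrt.div ((hasDerivAt_id s).add_const (a ^ 2)) hne).const_mul (a ^ 2))).congr_deriv ?_
  obtain ⟨t, ht, rfl⟩ : ∃ t : ℝ, 0 < t ∧ s = t ^ 2 :=
    ⟨√s, Real.sqrt_pos.2 hs, (Real.sq_sqrt hs.le).symm⟩
  simp only [Real.sqrt_sq ht.le, id]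
  have h₁ : a ^ 2 + t ^ 2 ≠ 0 := by positivity
  have h₂ : 1 + (t / a) ^ 2 = (a ^ 2 + t ^ 2) / a ^ 2 := by field_simp
  rw [h₂, add_comm (t ^ 2)]
  field_simp
  ring

open Filter Topology in
theorem lintegral_Ioi_sqrt_mul_div_sq {a : ℝ} (ha : 0 < a) :
    ∫⁻ s in Set.Ioi (0 : ℝ), ENNReal.ofReal (√s * (a ^ 2 / (a ^ 2 + s) ^ 2)) =
      ENNReal.ofReal (Real.pi / 2 * a) := by
  let F : ℝ → ℝ := fun s => a * Real.arctan (√s / a) - a ^ 2 * (√s / (s + a ^ 2))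
  have hcont : ContinuousWithinAt F (Set.Ici 0) 0 := by
    refine ContinuousAt.continuousWithinAt ?_
    have hne : (0 : ℝ) + a ^ 2 ≠ 0 := by positivity
    have h : ContinuousAt (fun s : ℝ => √s / (s + a ^ 2)) 0 :=
      Real.continuous_sqrt.continuousAt.div (by fun_prop) hne
    have h' : Continuous fun s : ℝ => a * Real.arctan (√s / a) := by fun_prop
    exact h'.continuousAt.sub (h.const_mul (a ^ 2))
  have hderiv : ∀ s ∈ Set.Ioi (0 : ℝ), HasDerivAt F (√s * (a ^ 2 / (a ^ 2 + s) ^ 2)) s :=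
    fun s hs => hasDerivAt_arctan_sqrt_div_sub ha hs
  have hpos : ∀ s ∈ Set.Ioi (0 : ℝ), 0 ≤ √s * (a ^ 2 / (a ^ 2 + s) ^ 2) :=
    fun s _ => by positivity
  have hlim : Tendsto F atTop (𝓝 (a * (Real.pi / 2) - a ^ 2 * 0)) := by
    have h : Tendsto (fun s : ℝ => Real.arctan (√s / a)) atTop (𝓝 (Real.pi / 2)) :=
      (Real.tendsto_arctan_atTop.mono_right nhdsWithin_le_nhds).comp
        (Real.tendsto_sqrt_atTop.atTop_div_const ha)
    exact (h.const_mul a).sub ((tendsto_sqrt_div_add_atTop_zero (sq_nonneg a)).const_mul _)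
  rw [← ofReal_integral_eq_lintegral_ofReal
      (integrableOn_Ioi_deriv_of_nonneg hcont hderiv hpos hlim)
      ((ae_restrict_iff' measurableSet_Ioi).2 (ae_of_all _ hpos)),
    integral_Ioi_of_hasDerivAt_of_nonneg hcont hderiv hpos hlim]
  congr 1
  simp [F]
  ring

/-- Fourier-side square-function identity for the homogeneous `H^{1/2}`-seminorm:
for every measurable `g : ℝ → ℂ`,
`∫₀^∞ √s · ((2/π) ∫ ξ²/(ξ²+s)² |g(ξ)|² dξ) ds = ∫ |ξ| |g(ξ)|² dξ`
as an identity in `[0,∞]`. -/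
theorem square_function_identity (g : ℝ → ℂ) (hg : Measurable g) :
    ∫⁻ s in Set.Ioi (0 : ℝ),
        ENNReal.ofReal (Real.sqrt s) *
          (ENNReal.ofReal (2 / Real.pi) *
            ∫⁻ ξ : ℝ, ENNReal.ofReal (ξ ^ 2 / (ξ ^ 2 + s) ^ 2 * ‖g ξ‖ ^ 2)) =
      ∫⁻ ξ : ℝ, ENNReal.ofReal (|ξ| * ‖g ξ‖ ^ 2) := by
  have hpi := Real.pi_pos
  have hpull : ∀ s : ℝ, ENNReal.ofReal √s * (ENNReal.ofReal (2 / Real.pi) *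
        ∫⁻ ξ : ℝ, ENNReal.ofReal (ξ ^ 2 / (ξ ^ 2 + s) ^ 2 * ‖g ξ‖ ^ 2)) =
      ∫⁻ ξ : ℝ, ENNReal.ofReal (2 / Real.pi * ‖g ξ‖ ^ 2) *
        ENNReal.ofReal (√s * (ξ ^ 2 / (ξ ^ 2 + s) ^ 2)) := by
    intro s
    rw [← mul_assoc, ← ENNReal.ofReal_mul (Real.sqrt_nonneg s),
      ← lintegral_const_mul _ (by fun_prop)]
    refine lintegral_congr fun ξ => ?_
    rw [← ENNReal.ofReal_mul (by positivity), ← ENNReal.ofReal_mul (by positivity)]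
    congr 1
    ring
  simp_rw [hpull]
  rw [lintegral_lintegral_swap (by fun_prop)]
  refine lintegral_congr fun ξ => ?_
  rw [lintegral_const_mul _ (by fun_prop)]
  rcases eq_or_ne ξ 0 with rfl | hξ
  · simp
  · have h := lintegral_Ioi_sqrt_mul_div_sq (abs_pos.2 hξ)
    simp only [sq_abs] at h
    rw [h, ← ENNReal.ofReal_mul (by positivity)]
    congr 1
    field_simp
end

section
/- Let T > 0, C ≥ 0, and let f : [0,T] → [0,∞) be continuous with f(t) ≤ f(0) + C ∫₀^t log(2 + f(τ)) · f(τ) dτ for every t ∈ [0,T]. Then 2 + f(t) ≤ (2 + f(0))^{exp(Ct)} for every t ∈ [0,T]. -/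
open MeasureTheory intervalIntegral

/-- **Logarithmic Gronwall lemma.** If `f : [0,T] → [0,∞)` is continuous and satisfies
`f(t) ≤ f(0) + C ∫₀^t log(2 + f(τ)) f(τ) dτ` on `[0,T]`, then
`2 + f(t) ≤ (2 + f(0))^{exp(Ct)}` on `[0,T]`. -/
theorem log_gronwall (T C : ℝ) (hT : 0 < T) (hC : 0 ≤ C) (f : ℝ → ℝ)
    (hf : ContinuousOn f (Set.Icc 0 T))
    (hf0 : ∀ t ∈ Set.Icc (0 : ℝ) T, 0 ≤ f t)
    (hineq : ∀ t ∈ Set.Icc (0 : ℝ) T,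
      f t ≤ f 0 + C * ∫ τ in (0 : ℝ)..t, Real.log (2 + f τ) * f τ) :
    ∀ t ∈ Set.Icc (0 : ℝ) T, 2 + f t ≤ (2 + f 0) ^ Real.exp (C * t) := by
  set h : ℝ → ℝ := fun τ => Real.log (2 + f τ) * f τ
  set G : ℝ → ℝ := fun t => 2 + f 0 + C * ∫ τ in (0 : ℝ)..t, h τ
  have hh : ContinuousOn h (Set.Icc 0 T) :=
    ((continuousOn_const.add hf).log fun t ht => by
      have := hf0 t ht
      exact (by linarith : 0 < 2 + f t).ne').mul hf
  have hfG : ∀ t ∈ Set.Icc (0 : ℝ) T, 2 + f t ≤ G t := fun t ht => by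
    have : f t ≤ f 0 + C * ∫ τ in (0 : ℝ)..t, h τ := hineq t ht
    simp only [G]
    linarith
  have hGpos : ∀ t ∈ Set.Icc (0 : ℝ) T, 0 < G t := fun t ht => by
    linarith [hfG t ht, hf0 t ht]
  have hGcont : ContinuousOn G (Set.Icc 0 T) := by
    have := continuousOn_primitive_interval (μ := volume) (a := 0) (b := T) (f := h)
      (by simpa [Set.uIcc_of_le hT.le] using hh.integrableOn_Icc)
    rw [Set.uIcc_of_le hT.le] at this
    exact continuousOn_const.add (continuousOn_const.mul this)
  have hGderiv : ∀ t ∈ Set.Ioo (0 : ℝ) T, HasDerivAt G (C * h t) t := fun t ht => by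
    refine ((integral_hasDerivAt_right ?_ ?_ ?_).const_mul C).const_add _
    · apply ContinuousOn.intervalIntegrable
      rw [Set.uIcc_of_le ht.1.le]
      exact hh.mono (Set.Icc_subset_Icc_right ht.2.le)
    · exact (hh.mono Set.Ioo_subset_Icc_self).stronglyMeasurableAtFilter isOpen_Ioo t ht
    · exact hh.continuousAt (Icc_mem_nhds ht.1 ht.2)
  have hderiv : ∀ t ∈ Set.Ioo (0 : ℝ) T,
      HasDerivAt (fun t => Real.exp (-(C * t)) * Real.log (G t))
        (Real.exp (-(C * t)) * (-(C * 1)) * Real.log (G t)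
          + Real.exp (-(C * t)) * (C * h t / G t)) t := fun t ht =>
    (((hasDerivAt_id t).const_mul C).neg.exp).mul
      ((hGderiv t ht).log (hGpos t (Set.Ioo_subset_Icc_self ht)).ne')
  have hanti : AntitoneOn (fun t => Real.exp (-(C * t)) * Real.log (G t)) (Set.Icc 0 T) := by
    refine antitoneOn_of_deriv_nonpos (convex_Icc 0 T) ?_ ?_ ?_
    · exact (by fun_prop : Continuous fun t => Real.exp (-(C * t))).continuousOn.mul
        (hGcont.log fun t ht => (hGpos t ht).ne')
    · rw [interior_Icc]
      exact fun t ht => (hderiv t ht).differentiableAt.differentiableWithinAt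
    · rw [interior_Icc]
      intro t ht
      rw [(hderiv t ht).deriv]
      have ht' := Set.Ioo_subset_Icc_self ht
      have hft := hf0 t ht'
      have hle := hfG t ht'
      have hlog : Real.log (2 + f t) ≤ Real.log (G t) := Real.log_le_log (by linarith) hle
      have hlog0 : 0 ≤ Real.log (2 + f t) := Real.log_nonneg (by linarith)
      have hhG : h t ≤ Real.log (G t) * G t :=
        mul_le_mul hlog (by linarith) hft (hlog0.trans hlog)
      have hquot : C * h t / G t ≤ C * Real.log (G t) := by
        rw [div_le_iff₀ (hGpos t ht'), mul_assoc]
        exact mul_le_mul_of_nonneg_left hhG hC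
      have := mul_le_mul_of_nonneg_left hquot (Real.exp_pos (-(C * t))).le
      linarith
  intro t ht
  have hmono := hanti (Set.left_mem_Icc.mpr hT.le) ht ht.1
  simp only [mul_zero, neg_zero, Real.exp_zero, one_mul] at hmono
  have hG0 : G 0 = 2 + f 0 := by simp [G]
  rw [hG0, Real.exp_neg, inv_mul_le_iff₀ (Real.exp_pos _)] at hmono
  have hpos : 0 < 2 + f 0 := hG0 ▸ hGpos 0 (Set.left_mem_Icc.mpr hT.le)
  refine (hfG t ht).trans ?_
  rwa [← Real.log_le_log_iff (hGpos t ht) (Real.rpow_pos_of_pos hpos _), Real.log_rpow hpos]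
end

section
/- Let T > 0, C ≥ 0, and let p > 2 be a real number. Suppose g : [0,T] → ℝ is continuously differentiable, g(t) ≥ 0 for all t, g(0) = 0, and |g'(t)| ≤ C · p · g(t)^{1 − 1/p} for all t ∈ [0,T]. Then g(t) ≤ (C·t)^p for every t ∈ [0,T]. -/
open MeasureTheory

/-- A nonnegative function with `g' ≤ C p g ^ (1 - 1 / p)` has `(g + δ) ^ (1 / p)` growing at
rate at most `C`, for every `δ > 0`. -/
theorem rpow_inv_add_le_of_hasDerivAt_le {T C p δ : ℝ} (hp : 1 < p) (hC : 0 ≤ C) (hδ : 0 < δ)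
    {g g' : ℝ → ℝ} (hderiv : ∀ t ∈ Set.Icc (0 : ℝ) T, HasDerivAt g (g' t) t)
    (hgnonneg : ∀ t ∈ Set.Icc (0 : ℝ) T, 0 ≤ g t)
    (hbound : ∀ t ∈ Set.Icc (0 : ℝ) T, g' t ≤ C * p * g t ^ (1 - 1 / p))
    {t : ℝ} (ht : t ∈ Set.Icc (0 : ℝ) T) :
    (g t + δ) ^ (1 / p) ≤ C * t + (g 0 + δ) ^ (1 / p) := by
  have hp0 : 0 < p := by linarith
  have hpos : ∀ s ∈ Set.Icc (0 : ℝ) T, 0 < g s + δ := fun s hs => by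
    linarith [hgnonneg s hs]
  have hd : ∀ s ∈ Set.Icc (0 : ℝ) T, HasDerivAt (fun r => (g r + δ) ^ (1 / p))
      (g' s * (1 / p) * (g s + δ) ^ (1 / p - 1)) s := fun s hs =>
    ((hderiv s hs).add_const δ).rpow_const (Or.inl (hpos s hs).ne')
  have hB : ∀ s : ℝ, HasDerivAt (fun r => C * r + (g 0 + δ) ^ (1 / p)) C s := fun s => by
    simpa using ((hasDerivAt_id s).const_mul C).add_const ((g 0 + δ) ^ (1 / p))
  refine image_le_of_deriv_right_le_deriv_boundary
    (f := fun r => (g r + δ) ^ (1 / p))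
    (fun s hs => (hd s hs).continuousAt.continuousWithinAt)
    (fun s hs => (hd s (Set.Ico_subset_Icc_self hs)).hasDerivWithinAt) (by simp)
    (fun s _ => (hB s).continuousAt.continuousWithinAt)
    (fun s _ => (hB s).hasDerivWithinAt) ?_ ht
  intro s hs
  replace hs := Set.Ico_subset_Icc_self hs
  have hexp : 0 ≤ 1 - 1 / p := by
    rw [sub_nonneg, div_le_one hp0]
    exact hp.le
  have hmono : g s ^ (1 - 1 / p) ≤ (g s + δ) ^ (1 - 1 / p) :=
    Real.rpow_le_rpow (hgnonneg s hs) (by linarith) hexp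
  have hcancel : (g s + δ) ^ (1 - 1 / p) * (g s + δ) ^ (1 / p - 1) = 1 := by
    rw [← Real.rpow_add (hpos s hs)]
    simp
  have hnn : 0 ≤ (g s + δ) ^ (1 / p - 1) := (Real.rpow_pos_of_pos (hpos s hs) _).le
  calc g' s * (1 / p) * (g s + δ) ^ (1 / p - 1)
      ≤ C * p * (g s + δ) ^ (1 - 1 / p) * (1 / p) * (g s + δ) ^ (1 / p - 1) := by
        gcongr
        exact (hbound s hs).trans (by gcongr)
    _ = C * (p * (1 / p)) * ((g s + δ) ^ (1 - 1 / p) * (g s + δ) ^ (1 / p - 1)) := by ring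
    _ = C := by rw [hcancel, mul_one_div_cancel hp0.ne', mul_one, mul_one]

/-- **ODE comparison lemma for the Judovic uniqueness argument.** Let `T > 0`, `C ≥ 0`,
`p > 2`. If `g : [0,T] → ℝ` is continuously differentiable with derivative `g'`,
`g ≥ 0`, `g(0) = 0`, and `|g'(t)| ≤ C p g(t)^{1−1/p}` on `[0,T]`, then
`g(t) ≤ (Ct)^p` on `[0,T]`. -/
theorem judovic_ode_comparison (T C p : ℝ) (hT : 0 < T) (hC : 0 ≤ C) (hp : 2 < p)
    (g g' : ℝ → ℝ)
    (hderiv : ∀ t ∈ Set.Icc (0 : ℝ) T, HasDerivAt g (g' t) t)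
    (hg'cont : ContinuousOn g' (Set.Icc 0 T))
    (hgnonneg : ∀ t ∈ Set.Icc (0 : ℝ) T, 0 ≤ g t)
    (hg0 : g 0 = 0)
    (hbound : ∀ t ∈ Set.Icc (0 : ℝ) T, |g' t| ≤ C * p * g t ^ (1 - 1 / p)) :
    ∀ t ∈ Set.Icc (0 : ℝ) T, g t ≤ (C * t) ^ p := by
  intro t ht
  have hp0 : 0 < p := by linarith
  have hroot : g t ^ (1 / p) ≤ C * t := by
    refine le_of_forall_pos_le_add fun ε hε => ?_
    have hδ : 0 < ε ^ p := Real.rpow_pos_of_pos hε p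
    have h := rpow_inv_add_le_of_hasDerivAt_le (by linarith) hC hδ hderiv hgnonneg
      (fun s hs => (le_abs_self _).trans (hbound s hs)) ht
    rw [hg0, zero_add, one_div, Real.rpow_rpow_inv hε.le hp0.ne', ← one_div] at h
    exact (Real.rpow_le_rpow (hgnonneg t ht) (by linarith) (by positivity)).trans h
  calc g t = (g t ^ (1 / p)) ^ p := by
        rw [one_div, Real.rpow_inv_rpow (hgnonneg t ht) hp0.ne']
    _ ≤ (C * t) ^ p :=
        Real.rpow_le_rpow (Real.rpow_nonneg (hgnonneg t ht) _) hroot hp0.le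
end
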